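/- Non-local operator bound on the exponential-polynomial weight: Let γ > 0, θ ≥ 0, λ ∈ ℝ, T > 0 and φ̂(x,t) = θ e^{−λt}(|x|^{2γ+2} + 1). Let ν be a positive Radon measure on ℝ^l∖{0} with ∫_{0<|z|≤1}|z|² ν(dz) + ∫_{|z|>1} e^{Λ₀|z|} ν(dz) ≤ Ã for some Λ₀ > 0 and Ã ≥ 1, and let η : ℝ^N×ℝ×ℝ^l → ℝ^N be Borel in z with |η_k(x,t,z)| ≤ B̃ min{|z|,1} for some B̃ ≥ 1. Then for every (x,t) ∈ ℝ^N×[0,T] the integral I(x,t,φ̂) = ∫_{ℝ^l∖{0}} [φ̂(x + η(x,t,z), t) − φ̂(x,t) − 1_{{|z|≤1}}(z)·Σ_{k=1}^N η_k(x,t,z) ∂_{x_k}φ̂(x,t)] ν(dz) converges absolutely, and |I(x,t,φ̂)| ≤ c·φ̂(x,t) for a constant c ≥ 1 depending only on N, B̃, Ã and γ. -/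

import Mathlib

open Set MeasureTheory

noncomputable section

abbrev Euc (n : ℕ) : Type := EuclideanSpace ℝ (Fin n)

/-- Spatial partial derivative `∂_{x_k} φ(x,t)`. -/
noncomputable def pd1 {N : ℕ} (φ : Euc N → ℝ → ℝ) (x : Euc N) (t : ℝ) (k : Fin N) : ℝ :=
  fderiv ℝ (fun x' => φ x' t) x (EuclideanSpace.single k 1)

/-- The integro-differential kernel `K(x,t,z,φ,p)`. -/
noncomputable def Kker {N l : ℕ} (η : Euc N → ℝ → Euc l → Euc N)
    (x : Euc N) (t : ℝ) (z : Euc l) (φ : Euc N → ℝ → ℝ) (p : Fin N → ℝ) : ℝ :=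
  φ (x + η x t z) t - φ x t - (if ‖z‖ ≤ 1 then ∑ k : Fin N, η x t z k * p k else 0)

/-- The exponential-polynomial weight `φ̂(x,t) = θ e^{-λt}(|x|^{2γ+2}+1)`. -/
noncomputable def weightFn (N : ℕ) (θ lam γ : ℝ) : Euc N → ℝ → ℝ :=
  fun x t => θ * Real.exp (-(lam * t)) * (‖x‖ ^ (2*γ+2 : ℝ) + 1)

/-- Tangent-line inequality for the convex function `s ↦ s ^ (γ + 1)` on `[0, ∞)`. -/
lemma rpow_tangent_le {γ u v : ℝ} (hγ : 0 < γ) (hu : 0 ≤ u) (hv : 0 ≤ v) :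
    (γ + 1) * v ^ γ * (u - v) ≤ u ^ (γ + 1) - v ^ (γ + 1) := by
  rcases hv.eq_or_lt with rfl | hv
  · rw [Real.zero_rpow hγ.ne', Real.zero_rpow (by positivity)]
    simp only [mul_zero, zero_mul, sub_zero]
    positivity
  · have h := one_add_mul_self_le_rpow_one_add (s := u / v - 1) (p := γ + 1)
      (by linarith [div_nonneg hu hv.le]) (by linarith)
    rw [add_sub_cancel, Real.div_rpow hu hv.le, le_div_iff₀ (by positivity)] at h
    have e : (1 + (γ + 1) * (u / v - 1)) * v ^ (γ + 1)
        = v ^ (γ + 1) + (γ + 1) * v ^ γ * (u - v) := by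
      rw [Real.rpow_add_one hv.ne']
      field_simp
    linarith

lemma rpow_sub_rpow_mul_le {q a b : ℝ} (hq : 0 < q) (hb : 0 ≤ b) (hba : b ≤ a) :
    (a ^ q - b ^ q) * a ≤ (1 + q) * a ^ q * (a - b) := by
  have h := rpow_tangent_le hq hb (hb.trans hba)
  have hb' : b ^ (q + 1) ≤ b ^ q * a := by
    rw [Real.rpow_add_one' hb (by positivity)]
    exact mul_le_mul_of_nonneg_left hba (by positivity)
  rw [Real.rpow_add_one' (hb.trans hba) (by positivity)] at h
  linarith

lemma rpow_sub_mul_sq_sub_le {q a b m d : ℝ} (hq : 0 < q) (ha : 0 ≤ a) (hb : 0 ≤ b)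
    (ham : a ≤ m) (hbm : b ≤ m) (hd : |a - b| ≤ d) :
    (a ^ q - b ^ q) * (a ^ 2 - b ^ 2) ≤ 2 * (1 + q) * m ^ q * d ^ 2 := by
  wlog hba : b ≤ a generalizing a b
  · have := this hb ha hbm ham (by rwa [abs_sub_comm]) (le_of_not_ge hba)
    linarith
  have h := rpow_sub_rpow_mul_le hq hb hba
  have h0 : 0 ≤ a ^ q - b ^ q := sub_nonneg.2 (Real.rpow_le_rpow hb hba hq.le)
  have hab : 0 ≤ a - b := sub_nonneg.2 hba
  rw [abs_of_nonneg hab] at hd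
  have hm : 0 ≤ m := ha.trans ham
  calc (a ^ q - b ^ q) * (a ^ 2 - b ^ 2)
      = (a ^ q - b ^ q) * (a - b) * (a + b) := by ring
    _ ≤ (a ^ q - b ^ q) * (a - b) * (2 * a) := by gcongr; linarith
    _ = 2 * ((a ^ q - b ^ q) * a) * (a - b) := by ring
    _ ≤ 2 * ((1 + q) * a ^ q * (a - b)) * (a - b) := by gcongr
    _ = 2 * (1 + q) * a ^ q * (a - b) ^ 2 := by ring
    _ ≤ 2 * (1 + q) * m ^ q * d ^ 2 := by gcongr

lemma sq_rpow_eq {a : ℝ} (ha : 0 ≤ a) (s : ℝ) : (a ^ 2) ^ s = a ^ (2 * s) := by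
  rw [Real.rpow_mul ha, Real.rpow_two]

/-- Second-order Taylor estimate for `x ↦ ‖x‖ ^ (2γ+2)`. -/
lemma abs_norm_rpow_taylor_le {E : Type*} [NormedAddCommGroup E] [InnerProductSpace ℝ E]
    {γ : ℝ} (hγ : 0 < γ) (x h : E) :
    |‖x + h‖ ^ (2 * γ + 2) - ‖x‖ ^ (2 * γ + 2) - (2 * γ + 2) * ‖x‖ ^ (2 * γ) * inner ℝ x h|
      ≤ (γ + 1) * (3 + 4 * γ) * (‖x‖ + ‖h‖) ^ (2 * γ) * ‖h‖ ^ 2 := by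
  have e : (2 * γ + 2 : ℝ) = 2 * (γ + 1) := by ring
  have hu := sq_nonneg ‖x + h‖
  have hv := sq_nonneg ‖x‖
  have h1 := rpow_tangent_le hγ hu hv
  have h2 := rpow_tangent_le hγ hv hu
  simp only [sq_rpow_eq (norm_nonneg _)] at h1 h2
  have h3 := rpow_sub_mul_sq_sub_le (q := 2 * γ) (d := ‖h‖) (by positivity)
    (norm_nonneg (x + h)) (norm_nonneg x) (norm_add_le x h) (by linarith [norm_nonneg h])
    ((abs_norm_sub_norm_le (x + h) x).trans (by simp))
  have h4 : ‖x‖ ^ (2 * γ) ≤ (‖x‖ + ‖h‖) ^ (2 * γ) := by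
    gcongr
    linarith [norm_nonneg h]
  have h5 := norm_add_sq_real x h
  have h6 : 0 ≤ ‖x‖ ^ (2 * γ) * ‖h‖ ^ 2 := by positivity
  have h7 := mul_le_mul_of_nonneg_right h4 (sq_nonneg ‖h‖)
  have h8 : (2 * γ + 2) * ‖x‖ ^ (2 * γ) * inner ℝ x h
      = (γ + 1) * ‖x‖ ^ (2 * γ) * (‖x + h‖ ^ 2 - ‖x‖ ^ 2)
        - (γ + 1) * (‖x‖ ^ (2 * γ) * ‖h‖ ^ 2) := by
    rw [h5]; ring
  have hg : 0 ≤ γ + 1 := by positivity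
  have h9 := mul_le_mul_of_nonneg_left h3 hg
  have h10 := mul_le_mul_of_nonneg_left h7 hg
  have h11 := mul_nonneg hg h6
  have h12 : 0 ≤ (γ + 1) * (3 + 4 * γ) * (‖x‖ + ‖h‖) ^ (2 * γ) * ‖h‖ ^ 2 := by positivity
  rw [h8, e, abs_le]
  constructor <;> linarith

lemma add_rpow_le_mul_rpow_add_one {a m p : ℝ} (ha : 0 ≤ a) (hm : 0 ≤ m) (hp : 0 < p) :
    (a + m) ^ p ≤ (1 + m) ^ p * (a ^ p + 1) := by
  have h1 : a + m ≤ (1 + m) * max a 1 := by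
    nlinarith [le_max_left a 1, mul_le_mul_of_nonneg_left (le_max_right a 1) hm]
  have h2 : max a 1 ^ p ≤ a ^ p + 1 := by
    rcases max_cases a 1 with ⟨h, -⟩ | ⟨h, -⟩ <;> rw [h]
    · linarith
    · rw [Real.one_rpow]
      linarith [Real.rpow_nonneg ha p]
  calc (a + m) ^ p ≤ ((1 + m) * max a 1) ^ p := by gcongr
    _ = (1 + m) ^ p * max a 1 ^ p := Real.mul_rpow (by positivity) (by positivity)
    _ ≤ _ := by gcongr

lemma sum_mul_pd1_weightFn {N : ℕ} (θ lam : ℝ) {γ : ℝ} (hγ : 0 < γ) (x h : Euc N) (t : ℝ) :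
    ∑ k : Fin N, h k * pd1 (weightFn N θ lam γ) x t k
      = θ * Real.exp (-(lam * t)) * ((2 * γ + 2) * ‖x‖ ^ (2 * γ) * inner ℝ x h) := by
  have hd := ((hasFDerivAt_norm_rpow x (p := 2 * γ + 2) (by linarith)).add_const 1).const_mul
    (θ * Real.exp (-(lam * t)))
  have hh : ∑ k : Fin N, h k • EuclideanSpace.single k (1 : ℝ) = h := by
    ext i
    simp [Pi.single_apply]
  have hf : fderiv ℝ (fun x' => weightFn N θ lam γ x' t) x h
      = θ * Real.exp (-(lam * t)) * ((2 * γ + 2) * ‖x‖ ^ (2 * γ) * inner ℝ x h) := by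
    have : (fun x' => weightFn N θ lam γ x' t)
        = fun x' => θ * Real.exp (-(lam * t)) * (‖x'‖ ^ (2 * γ + 2) + 1) := rfl
    rw [this, hd.fderiv]
    simp
  rw [← hf]
  conv_rhs => rw [← hh]
  simp [pd1, map_sum]

lemma euclidean_norm_le_of_abs_le {N : ℕ} {h : Euc N} {b : ℝ} (hb : ∀ k, |h k| ≤ b) :
    ‖h‖ ≤ N * b := by
  have hh : ∑ k : Fin N, EuclideanSpace.single k (h k) = h := by
    ext i
    simp [Pi.single_apply]
  calc ‖h‖ = ‖∑ k : Fin N, EuclideanSpace.single k (h k)‖ := by rw [hh]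
    _ ≤ ∑ k : Fin N, ‖EuclideanSpace.single k (h k)‖ := norm_sum_le _ _
    _ ≤ ∑ _k : Fin N, b := Finset.sum_le_sum fun k _ => by simpa using hb k
    _ = N * b := by simp

lemma measurable_Kker {N l : ℕ} {η : Euc N → ℝ → Euc l → Euc N} {x : Euc N} {t : ℝ}
    (hη : Measurable fun z => η x t z) {φ : Euc N → ℝ → ℝ} (hφ : Measurable fun y => φ y t)
    (p : Fin N → ℝ) : Measurable fun z => Kker η x t z φ p := by
  unfold Kker
  refine ((hφ.comp (hη.const_add x)).sub_const _).sub (Measurable.ite ?_ ?_ measurable_const)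
  · exact measurableSet_le measurable_norm measurable_const
  · refine Finset.measurable_sum _ fun k _ => Measurable.mul_const ?_ _
    exact (EuclideanSpace.proj (𝕜 := ℝ) k).continuous.measurable.comp hη

lemma measurable_weightFn (N : ℕ) (θ lam γ t : ℝ) :
    Measurable fun y => weightFn N θ lam γ y t := by
  unfold weightFn
  fun_prop

lemma weightFn_nonneg {N : ℕ} {θ : ℝ} (hθ : 0 ≤ θ) (lam γ : ℝ) (x : Euc N) (t : ℝ) :
    0 ≤ weightFn N θ lam γ x t := by
  unfold weightFn
  positivity

/-- Bound on the compensated kernel for small jumps. -/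
lemma abs_Kker_weightFn_le_small {N l : ℕ} {γ θ M : ℝ} (hγ : 0 < γ) (hθ : 0 ≤ θ) (hM : 0 ≤ M)
    (lam : ℝ) (η : Euc N → ℝ → Euc l → Euc N) (x : Euc N) (t : ℝ) {z : Euc l} (hz : ‖z‖ ≤ 1)
    (hη : ‖η x t z‖ ≤ M * ‖z‖) :
    |Kker η x t z (weightFn N θ lam γ) (pd1 (weightFn N θ lam γ) x t)|
      ≤ (γ + 1) * (3 + 4 * γ) * (2 + M) ^ (2 * γ + 2) * M ^ 2 * weightFn N θ lam γ x t
        * ‖z‖ ^ 2 := by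
  have hηM : ‖η x t z‖ ≤ M := hη.trans (mul_le_of_le_one_right hM hz)
  have h1 : (‖x‖ + ‖η x t z‖) ^ (2 * γ) ≤ (2 + M) ^ (2 * γ + 2) * (‖x‖ ^ (2 * γ + 2) + 1) := by
    calc (‖x‖ + ‖η x t z‖) ^ (2 * γ) ≤ (‖x‖ + (1 + M)) ^ (2 * γ) := by
          gcongr
          linarith
      _ ≤ (‖x‖ + (1 + M)) ^ (2 * γ + 2) :=
          Real.rpow_le_rpow_of_exponent_le (by linarith [norm_nonneg x]) (by linarith)
      _ ≤ (1 + (1 + M)) ^ (2 * γ + 2) * (‖x‖ ^ (2 * γ + 2) + 1) :=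
          add_rpow_le_mul_rpow_add_one (norm_nonneg x) (by positivity) (by positivity)
      _ = _ := by ring_nf
  have hK : Kker η x t z (weightFn N θ lam γ) (pd1 (weightFn N θ lam γ) x t)
      = θ * Real.exp (-(lam * t)) * (‖x + η x t z‖ ^ (2 * γ + 2) - ‖x‖ ^ (2 * γ + 2)
        - (2 * γ + 2) * ‖x‖ ^ (2 * γ) * inner ℝ x (η x t z)) := by
    rw [Kker, if_pos hz, sum_mul_pd1_weightFn θ lam hγ]
    simp only [weightFn]
    ring
  rw [hK, abs_mul, abs_of_nonneg (by positivity : 0 ≤ θ * Real.exp (-(lam * t)))]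
  calc θ * Real.exp (-(lam * t)) * |‖x + η x t z‖ ^ (2 * γ + 2) - ‖x‖ ^ (2 * γ + 2)
        - (2 * γ + 2) * ‖x‖ ^ (2 * γ) * inner ℝ x (η x t z)|
      ≤ θ * Real.exp (-(lam * t)) * ((γ + 1) * (3 + 4 * γ) * (‖x‖ + ‖η x t z‖) ^ (2 * γ)
        * ‖η x t z‖ ^ 2) := by
        gcongr
        exact abs_norm_rpow_taylor_le hγ x _
    _ ≤ θ * Real.exp (-(lam * t)) * ((γ + 1) * (3 + 4 * γ)
        * ((2 + M) ^ (2 * γ + 2) * (‖x‖ ^ (2 * γ + 2) + 1)) * (M * ‖z‖) ^ 2) := by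
        gcongr
    _ = _ := by
        simp only [weightFn]
        ring

/-- Bound on the uncompensated kernel for large jumps. -/
lemma abs_Kker_weightFn_le_large {N l : ℕ} {γ θ M : ℝ} (hγ : 0 < γ) (hθ : 0 ≤ θ) (hM : 0 ≤ M)
    (lam : ℝ) (η : Euc N → ℝ → Euc l → Euc N) (x : Euc N) (t : ℝ) {z : Euc l} (hz : 1 < ‖z‖)
    (hη : ‖η x t z‖ ≤ M) :
    |Kker η x t z (weightFn N θ lam γ) (pd1 (weightFn N θ lam γ) x t)|
      ≤ (2 + M) ^ (2 * γ + 2) * weightFn N θ lam γ x t := by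
  have hle : ∀ y : Euc N, ‖y‖ ≤ ‖x‖ + (1 + M) →
      ‖y‖ ^ (2 * γ + 2) ≤ (2 + M) ^ (2 * γ + 2) * (‖x‖ ^ (2 * γ + 2) + 1) := fun y hy => by
    calc ‖y‖ ^ (2 * γ + 2) ≤ (‖x‖ + (1 + M)) ^ (2 * γ + 2) := by gcongr
      _ ≤ (1 + (1 + M)) ^ (2 * γ + 2) * (‖x‖ ^ (2 * γ + 2) + 1) :=
          add_rpow_le_mul_rpow_add_one (norm_nonneg x) (by positivity) (by positivity)
      _ = _ := by ring_nf
  have h1 := hle (x + η x t z) (by linarith [norm_add_le x (η x t z)])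
  have h2 := hle x (by linarith)
  have hK : Kker η x t z (weightFn N θ lam γ) (pd1 (weightFn N θ lam γ) x t)
      = θ * Real.exp (-(lam * t)) * (‖x + η x t z‖ ^ (2 * γ + 2) - ‖x‖ ^ (2 * γ + 2)) := by
    rw [Kker, if_neg (not_le.2 hz)]
    simp only [weightFn]
    ring
  rw [hK, abs_mul, abs_of_nonneg (by positivity : 0 ≤ θ * Real.exp (-(lam * t)))]
  calc θ * Real.exp (-(lam * t)) * |‖x + η x t z‖ ^ (2 * γ + 2) - ‖x‖ ^ (2 * γ + 2)|
      ≤ θ * Real.exp (-(lam * t)) * ((2 + M) ^ (2 * γ + 2) * (‖x‖ ^ (2 * γ + 2) + 1)) := by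
        gcongr
        have p1 : 0 ≤ ‖x‖ ^ (2 * γ + 2) := by positivity
        have p2 : 0 ≤ ‖x + η x t z‖ ^ (2 * γ + 2) := by positivity
        rw [abs_le]
        constructor <;> linarith
    _ = _ := by
        simp only [weightFn]
        ring

/-- Non-local operator bound on the exponential-polynomial weight: the integral
`I(x,t,φ̂)` converges absolutely and `|I(x,t,φ̂)| ≤ c φ̂(x,t)` with `c = c(N,B̃,Ã,γ)`. -/
theorem weight_nonlocal_bound
    (N l : ℕ) (Bt At γ : ℝ) (hB : 1 ≤ Bt) (hA : 1 ≤ At) (hγ : 0 < γ) :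
    ∃ c : ℝ, 1 ≤ c ∧
      ∀ (Λ₀ θ lam T : ℝ), 0 < Λ₀ → 0 ≤ θ → 0 < T →
      ∀ (ν : Measure (Euc l)) (η : Euc N → ℝ → Euc l → Euc N),
      ν ({0} : Set (Euc l)) = 0 →
      IntegrableOn (fun z : Euc l => ‖z‖ ^ 2) {z | 0 < ‖z‖ ∧ ‖z‖ ≤ 1} ν →
      IntegrableOn (fun z : Euc l => Real.exp (Λ₀ * ‖z‖)) {z | 1 < ‖z‖} ν →
      (∫ z in {z : Euc l | 0 < ‖z‖ ∧ ‖z‖ ≤ 1}, ‖z‖ ^ 2 ∂ν)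
        + (∫ z in {z : Euc l | 1 < ‖z‖}, Real.exp (Λ₀ * ‖z‖) ∂ν) ≤ At →
      (∀ (x : Euc N) (t : ℝ), Measurable (fun z => η x t z)) →
      (∀ (x : Euc N) (t : ℝ) (z : Euc l) (k : Fin N), |η x t z k| ≤ Bt * min ‖z‖ 1) →
      ∀ (x : Euc N), ∀ t ∈ Icc (0:ℝ) T,
        IntegrableOn
          (fun z => Kker η x t z (weightFn N θ lam γ) (pd1 (weightFn N θ lam γ) x t))
          {z : Euc l | z ≠ 0} ν ∧
        |∫ z in {z : Euc l | z ≠ 0},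
            Kker η x t z (weightFn N θ lam γ) (pd1 (weightFn N θ lam γ) x t) ∂ν|
          ≤ c * weightFn N θ lam γ x t := by
  set M : ℝ := N * Bt with hMdef
  have hM : 0 ≤ M := by positivity
  set D : ℝ := (2 + M) ^ (2 * γ + 2) with hDdef
  have hD : 1 ≤ D := Real.one_le_rpow (by linarith) (by linarith)
  set C : ℝ := (γ + 1) * (3 + 4 * γ) * D * M ^ 2 with hCdef
  have hC : 0 ≤ C := by positivity
  refine ⟨(C + D) * At, one_le_mul_of_one_le_of_one_le (by linarith) hA, ?_⟩
  intro Λ₀ θ lam T hΛ hθ _ ν η _ hI1 hI2 hsum hmeas hη x t _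
  set W := weightFn N θ lam γ x t with hW
  have hW0 : 0 ≤ W := weightFn_nonneg hθ lam γ x t
  have hηM : ∀ z, ‖η x t z‖ ≤ M * min ‖z‖ 1 := fun z =>
    (euclidean_norm_le_of_abs_le (hη x t z)).trans (by rw [hMdef, mul_assoc])
  set F : Euc l → ℝ := fun z =>
    Kker η x t z (weightFn N θ lam γ) (pd1 (weightFn N θ lam γ) x t) with hF
  set S₁ : Set (Euc l) := {z | 0 < ‖z‖ ∧ ‖z‖ ≤ 1} with hS₁
  set S₂ : Set (Euc l) := {z | 1 < ‖z‖} with hS₂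
  have hFm : Measurable F := measurable_Kker (hmeas x t) (measurable_weightFn N θ lam γ t) _
  have hS₂m : MeasurableSet S₂ := measurableSet_lt measurable_const measurable_norm
  have hS₁m : MeasurableSet S₁ := (measurableSet_lt measurable_const measurable_norm).inter
    (measurableSet_le measurable_norm measurable_const)
  have hS : {z : Euc l | z ≠ 0} = S₁ ∪ S₂ := by
    ext z
    have hz : z ≠ 0 ↔ 0 < ‖z‖ := norm_pos_iff.symm
    simp only [hS₁, hS₂, mem_ofPred_eq, mem_union, hz]
    refine ⟨fun h => (le_or_gt ‖z‖ 1).imp (fun h' => ⟨h, h'⟩) id, ?_⟩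
    rintro (h | h)
    · exact h.1
    · linarith
  have hdisj : Disjoint S₁ S₂ :=
    Set.disjoint_left.2 fun z h₁ h₂ => absurd h₁.2 (not_le.2 h₂)
  have hb₁ : ∀ᵐ z ∂ν.restrict S₁, ‖F z‖ ≤ (C + D) * W * ‖z‖ ^ 2 := by
    refine ae_restrict_of_forall_mem hS₁m fun z hz => ?_
    have h := abs_Kker_weightFn_le_small hγ hθ hM lam η x t hz.2
      ((hηM z).trans (by gcongr; exact min_le_left _ _))
    rw [Real.norm_eq_abs]
    refine h.trans ?_
    gcongr
    linarith
  have hb₂ : ∀ᵐ z ∂ν.restrict S₂, ‖F z‖ ≤ (C + D) * W * Real.exp (Λ₀ * ‖z‖) := by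
    refine ae_restrict_of_forall_mem hS₂m fun z hz => ?_
    have h := abs_Kker_weightFn_le_large hγ hθ hM lam η x t hz
      ((hηM z).trans (mul_le_of_le_one_right hM (min_le_right _ _)))
    rw [Real.norm_eq_abs]
    calc |F z| ≤ D * W := h
      _ ≤ (C + D) * W := by gcongr; linarith
      _ ≤ (C + D) * W * Real.exp (Λ₀ * ‖z‖) :=
        le_mul_of_one_le_right (by positivity) (Real.one_le_exp (by positivity))
  have hG₁ := hI1.integrable.const_mul ((C + D) * W)
  have hG₂ := hI2.integrable.const_mul ((C + D) * W)
  have hF₁ : IntegrableOn F S₁ ν := hG₁.mono' hFm.aestronglyMeasurable hb₁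
  have hF₂ : IntegrableOn F S₂ ν := hG₂.mono' hFm.aestronglyMeasurable hb₂
  rw [hS]
  refine ⟨hF₁.union hF₂, ?_⟩
  rw [setIntegral_union hdisj hS₂m hF₁ hF₂]
  have hn₁ := norm_integral_le_of_norm_le hG₁ hb₁
  have hn₂ := norm_integral_le_of_norm_le hG₂ hb₂
  rw [integral_const_mul, Real.norm_eq_abs] at hn₁ hn₂
  have hfin := mul_le_mul_of_nonneg_left hsum (by positivity : 0 ≤ (C + D) * W)
  refine (abs_add_le _ _).trans ?_
  linarith

end
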